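/- There is no finite group of order 1280 (= 32·40 = 2⁸·5) that has an irreducible complex character of degree 32. -/

import Mathlib

open CategoryTheory

/-- `χ : G → ℂ` is the character of an irreducible (simple) finite-dimensional complex
representation of the group `G`. -/
def IsIrrChar (G : Type) [Group G] (χ : G → ℂ) : Prop :=
  ∃ V : FDRep ℂ G, Simple V ∧ FDRep.character V = χ

/-- A complex endomorphism of finite order and its inverse have conjugate traces. -/
theorem Module.End.trace_inverse_eq_star_trace {V : Type*} [AddCommGroup V] [Module ℂ V]
    [FiniteDimensional ℂ V] {f g : Module.End ℂ V} (hgf : g * f = 1) {n : ℕ} (hn : n ≠ 0)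
    (hf : f ^ n = 1) :
    LinearMap.trace ℂ V g = star (LinearMap.trace ℂ V f) := by
  have hsemi : f.IsSemisimple := by
    refine Module.End.isSemisimple_of_squarefree_aeval_eq_zero
      (p := Polynomial.X ^ n - 1) ?_ (by simp [hf])
    exact (Polynomial.X_pow_sub_one_separable_iff.2 (by exact_mod_cast hn)).squarefree
  have htop : ⨆ μ, f.eigenspace μ = ⊤ := hsemi.iSup_eigenspace_eq_top
  have hint := DirectSum.isInternal_submodule_of_iSupIndep_of_iSup_eq_top
    f.eigenspaces_iSupIndep htop
  have hfin : {μ | f.eigenspace μ ≠ ⊥}.Finite :=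
    WellFoundedGT.finite_ne_bot_of_iSupIndep f.eigenspaces_iSupIndep
  have hfv : ∀ μ, ∀ v ∈ f.eigenspace μ, f v = μ • v := fun μ v hv ↦
    Module.End.mem_eigenspace_iff.1 hv
  have hroot : ∀ μ, ∀ v ∈ f.eigenspace μ, v ≠ 0 → star μ * μ = 1 := by
    intro μ v hv hv0
    have hpow : ∀ k : ℕ, (f ^ k) v = μ ^ k • v := by
      intro k
      induction k with
      | zero => simp
      | succ k ih => rw [pow_succ', Module.End.mul_apply, ih, map_smul, hfv μ v hv, smul_smul,
          pow_succ]
    have h1 := hpow n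
    rw [hf, Module.End.one_apply] at h1
    have h2 : μ ^ n = 1 := smul_left_injective ℂ hv0 (by simpa using h1.symm)
    have h3 : ‖μ‖ = 1 := Complex.norm_eq_one_of_pow_eq_one h2 hn
    rw [Complex.star_def, Complex.conj_mul', h3]
    simp
  have hgv : ∀ μ, ∀ v ∈ f.eigenspace μ, g v = star μ • v := by
    intro μ v hv
    by_cases hv0 : v = 0
    · simp [hv0]
    have h : g (f v) = v := by rw [← Module.End.mul_apply, hgf, Module.End.one_apply]
    rw [hfv μ v hv, map_smul] at h
    calc g v = (star μ * μ) • g v := by rw [hroot μ v hv hv0, one_smul]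
      _ = star μ • v := by rw [mul_smul, h]
  have trace_of_scalar : ∀ (h : Module.End ℂ V) (c : ℂ → ℂ)
      (_ : ∀ μ, ∀ v ∈ f.eigenspace μ, h v = c μ • v),
      LinearMap.trace ℂ V h =
        ∑ μ ∈ hfin.toFinset, c μ * (Module.finrank ℂ (f.eigenspace μ) : ℂ) := by
    intro h c hc
    have hmaps : ∀ μ, Set.MapsTo h (f.eigenspace μ) (f.eigenspace μ) := by
      intro μ v hv
      rw [hc μ v hv]
      exact Submodule.smul_mem _ _ hv
    rw [LinearMap.trace_eq_sum_trace_restrict' hint hfin hmaps]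
    refine Finset.sum_congr rfl fun μ _ ↦ ?_
    have : h.restrict (hmaps μ) = c μ • (1 : Module.End ℂ (f.eigenspace μ)) := by
      ext v
      exact hc μ v v.2
    rw [this, map_smul, LinearMap.trace_one, smul_eq_mul]
  rw [trace_of_scalar f id hfv, trace_of_scalar g star hgv, star_sum]
  simp

/-- The values of a complex character of a finite group at inverse elements are conjugate. -/
theorem Representation.character_inv_eq_star {G V : Type*} [Group G] [Finite G]
    [AddCommGroup V] [Module ℂ V] [FiniteDimensional ℂ V] (ρ : Representation ℂ G V) (g : G) :
    ρ.character g⁻¹ = star (ρ.character g) :=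
  Module.End.trace_inverse_eq_star_trace (f := ρ g) (g := ρ g⁻¹)
    (by rw [← map_mul, inv_mul_cancel, map_one]) (Nat.card_pos (α := G)).ne'
    (by rw [← map_pow, pow_card_eq_one', map_one])

/-- The sum of the values of a character over a subgroup is a multiple of its order. -/
theorem Representation.exists_sum_character_subgroup {G V : Type*} [Group G] [Finite G]
    [AddCommGroup V] [Module ℂ V] [FiniteDimensional ℂ V] (ρ : Representation ℂ G V)
    (H : Subgroup G) [Fintype H] :
    ∃ m : ℕ, ∑ h : H, ρ.character (h : G) = (Nat.card H : ℂ) * m := by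
  have hne : (Nat.card H : ℂ) ≠ 0 := by exact_mod_cast (Nat.card_pos (α := H)).ne'
  have : Invertible (Nat.card H : ℂ) := invertibleOfNonzero hne
  refine ⟨Module.finrank ℂ (Representation.invariants (ρ.comp H.subtype)), ?_⟩
  rw [← Representation.card_inv_mul_sum_char_eq_finrank, mul_inv_cancel_left₀ hne]
  rfl

/-- The sum of the squared absolute values of a character over a subgroup is a multiple of
its order. -/
theorem Representation.exists_sum_norm_sq_character_subgroup {G V : Type*} [Group G] [Finite G]
    [AddCommGroup V] [Module ℂ V] [FiniteDimensional ℂ V] (ρ : Representation ℂ G V)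
    (H : Subgroup G) [Fintype H] :
    ∃ m : ℕ, ∑ h : H, ‖ρ.character (h : G)‖ ^ 2 = (Nat.card H : ℝ) * m := by
  obtain ⟨m, hm⟩ := (Representation.linHom ρ ρ).exists_sum_character_subgroup H
  refine ⟨m, ?_⟩
  simp_rw [Representation.char_linHom, Representation.character_inv_eq_star, Complex.star_def,
    Complex.conj_mul'] at hm
  exact_mod_cast hm

/-- If the character of a representation of a finite group vanishes on the nontrivial elements
of a subgroup, then the order of that subgroup divides the degree. -/
theorem Representation.card_dvd_finrank_of_character_eq_zero {G V : Type*} [Group G] [Finite G]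
    [AddCommGroup V] [Module ℂ V] [FiniteDimensional ℂ V] (ρ : Representation ℂ G V)
    (H : Subgroup G) (hH : ∀ h ∈ H, h ≠ 1 → ρ.character h = 0) :
    Nat.card H ∣ Module.finrank ℂ V := by
  classical
  have := Fintype.ofFinite H
  obtain ⟨m, hm⟩ := ρ.exists_sum_character_subgroup H
  rw [Fintype.sum_eq_single (1 : H) fun h hh ↦ hH h h.2 (by simpa using hh)] at hm
  rw [Subgroup.coe_one, Representation.char_one] at hm
  exact ⟨m, by exact_mod_cast hm⟩

/-- First orthogonality relation for a single irreducible character, in terms of absolute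
values. -/
theorem FDRep.sum_norm_sq_character {G : Type} [Group G] [Fintype G] (V : FDRep ℂ G)
    [Simple V] : ∑ g : G, ‖Representation.character V.ρ g‖ ^ 2 = (Nat.card G : ℝ) := by
  classical
  have hne : (Nat.card G : ℂ) ≠ 0 := by exact_mod_cast (Nat.card_pos (α := G)).ne'
  have : Invertible (Nat.card G : ℂ) := invertibleOfNonzero hne
  have h := FDRep.char_orthonormal V V
  rw [if_pos ⟨Iso.refl V⟩, inv_mul_eq_iff_eq_mul₀ hne, mul_one] at h
  have hsum : ∑ g : G, Representation.character V.ρ g * Representation.character V.ρ g⁻¹ =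
      (Nat.card G : ℂ) := h
  simp_rw [Representation.character_inv_eq_star, Complex.star_def, Complex.mul_conj'] at hsum
  exact_mod_cast hsum

/-- There is no finite group of order 1280 with an irreducible complex character
of degree 32. -/
theorem no_group_order_1280_degree_32 (G : Type) [Group G] [Finite G]
    (hcard : Nat.card G = 1280)
    (χ : G → ℂ) (hχ : IsIrrChar G χ) (hdeg : χ 1 = (32 : ℂ)) :
    False := by
  classical
  obtain ⟨V, hV, rfl⟩ := hχ
  have := Fintype.ofFinite G
  have hdim : Module.finrank ℂ V = 32 := by
    rw [FDRep.char_one] at hdeg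
    exact_mod_cast hdeg
  set ψ := Representation.character V.ρ with hψ
  have hψ1 : ψ 1 = 32 := hdeg
  have hG : ∑ g : G, ‖ψ g‖ ^ 2 = 1280 := by
    rw [FDRep.sum_norm_sq_character, hcard]
    norm_num
  have : Fact (Nat.Prime 2) := ⟨Nat.prime_two⟩
  have : Fact (Nat.Prime 5) := ⟨Nat.prime_five⟩
  obtain ⟨P, hP⟩ := Sylow.exists_subgroup_card_pow_prime (G := G) 2 (n := 8)
    (by rw [hcard]; norm_num)
  obtain ⟨m, hm⟩ := Representation.exists_sum_norm_sq_character_subgroup V.ρ P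
  rw [← hψ, hP] at hm
  rw [← Finset.sum_subtype (Finset.univ.filter (· ∈ P)) (by simp) fun g ↦ ‖ψ g‖ ^ 2] at hm
  have hsplit := Finset.sum_filter_add_sum_filter_not Finset.univ (· ∈ P) fun g ↦ ‖ψ g‖ ^ 2
  rw [hG, hm] at hsplit
  have hone := Finset.sum_erase_add (Finset.univ.filter (· ∈ P)) (fun g ↦ ‖ψ g‖ ^ 2)
    (a := 1) (by simp [P.one_mem])
  have hnorm : ‖ψ 1‖ ^ 2 = 1024 := by rw [hψ1]; norm_num
  rw [hm, hnorm] at hone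
  have hnonneg : ∀ s : Finset G, 0 ≤ ∑ g ∈ s, ‖ψ g‖ ^ 2 :=
    fun s ↦ Finset.sum_nonneg fun g _ ↦ by positivity
  have hvanish : ∀ s : Finset G, ∑ g ∈ s, ‖ψ g‖ ^ 2 = 0 → ∀ g ∈ s, ψ g = 0 := by
    intro s hs g hg
    simpa using (Finset.sum_eq_zero_iff_of_nonneg fun g _ ↦ by positivity).1 hs g hg
  have hm4 : 4 ≤ m := by
    have := hnonneg ((Finset.univ.filter (· ∈ P)).erase 1)
    have : (4 : ℝ) ≤ m := by push_cast at hone; linarith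
    exact_mod_cast this
  have hm5 : m ≤ 5 := by
    have := hnonneg (Finset.univ.filter (· ∉ P))
    have : (m : ℝ) ≤ 5 := by push_cast at hsplit; linarith
    exact_mod_cast this
  obtain rfl | rfl : m = 4 ∨ m = 5 := by omega
  · have hzero := hvanish _ (by push_cast at hone; linarith)
    have hdvd := Representation.card_dvd_finrank_of_character_eq_zero V.ρ P
      fun h hh h1 ↦ hzero h (by simp [hh, h1])
    rw [hP, hdim] at hdvd
    norm_num at hdvd
  · have hzero := hvanish (Finset.univ.filter (· ∉ P)) (by push_cast at hsplit; linarith)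
    obtain ⟨Q, hQ⟩ := Sylow.exists_subgroup_card_pow_prime (G := G) 5 (n := 1)
      (by rw [hcard]; norm_num)
    have hPQ : Disjoint P Q := Subgroup.disjoint_of_coprime_natCard (by rw [hP, hQ]; norm_num)
    have hdvd := Representation.card_dvd_finrank_of_character_eq_zero V.ρ Q
      fun h hh h1 ↦ hzero h (by
        simpa using fun hp ↦ h1 (Subgroup.disjoint_def.1 hPQ hp hh))
    rw [hQ, hdim] at hdvd
    norm_num at hdvd
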